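/- The joint law of the reference path and the conditional SMC particles together with the backward-sampling indices satisfies the exchange identity: π(dz) Φ(z, d(k, ζ)) = ψ̄(dζ) Φ̌(ζ, d(k, z)) as measures on Z^T × {1,…,M}^T × Z^{MT}. -/

import Mathlib

open MeasureTheory ProbabilityTheory
open scoped ENNReal

noncomputable section

namespace CSMC

variable {Z : Type*} [MeasurableSpace Z]

/-- Unnormalised target density along a path: `∏_t w_t(z_t) ∏_t f(z_{t-1}, z_t)`. -/
def pathDens {n : ℕ} (f : Z → Z → ℝ) (w : Fin (n + 1) → Z → ℝ)
    (z : Fin (n + 1) → Z) : ℝ≥0∞ :=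
  (∏ t : Fin (n + 1), ENNReal.ofReal (w t (z t)))
    * ∏ s : Fin n, ENNReal.ofReal (f (z s.castSucc) (z s.succ))

/-- Base measure on path space: coordinate `0` carries `μ`, the others `λ`. -/
def pathBase (lam μ : Measure Z) (n : ℕ) : Measure (Fin (n + 1) → Z) :=
  Measure.pi (fun i => if i = 0 then μ else lam)

/-- The target `π(dz) = C⁻¹ ∏_t w_t(z_t) μ(dz₁) ∏_t F(z_{t-1}, dz_t)`. -/
def targetLaw (lam μ : Measure Z) {n : ℕ} (f : Z → Z → ℝ) (w : Fin (n + 1) → Z → ℝ)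
    (C : ℝ≥0∞) : Measure (Fin (n + 1) → Z) :=
  (pathBase lam μ n).withDensity (fun z => C⁻¹ * pathDens f w z)

/-- Base measure on particle space: time-`0` particles carry `μ`, the others `λ`. -/
def particleBase (lam μ : Measure Z) (n M : ℕ) : Measure (Fin (n + 1) → Fin M → Z) :=
  Measure.pi (fun t => Measure.pi (fun _ : Fin M => if t = 0 then μ else lam))

/-- Density of the multinomial-resampling transitions of the bootstrap particle filter. -/
def resampleDens {n M : ℕ} (f : Z → Z → ℝ) (w : Fin (n + 1) → Z → ℝ)
    (ζ : Fin (n + 1) → Fin M → Z) : ℝ≥0∞ :=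
  ∏ s : Fin n, ∏ i : Fin M,
    (∑ j : Fin M, ENNReal.ofReal (w s.castSucc (ζ s.castSucc j))
        * ENNReal.ofReal (f (ζ s.castSucc j) (ζ s.succ i)))
      / ∑ j : Fin M, ENNReal.ofReal (w s.castSucc (ζ s.castSucc j))

/-- The marginal law `ψ` of the particles of the bootstrap particle filter. -/
def smcLaw (lam μ : Measure Z) (M : ℕ) {n : ℕ} (f : Z → Z → ℝ)
    (w : Fin (n + 1) → Z → ℝ) : Measure (Fin (n + 1) → Fin M → Z) :=
  (particleBase lam μ n M).withDensity (resampleDens f w)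

/-- The normalising-constant estimator `Ĉ(ζ) = ∏_t M⁻¹ ∑_i w_t(ζ_t^{(i)})`. -/
def Chat (M : ℕ) {n : ℕ} (w : Fin (n + 1) → Z → ℝ)
    (ζ : Fin (n + 1) → Fin M → Z) : ℝ≥0∞ :=
  ∏ t : Fin (n + 1), (M : ℝ≥0∞)⁻¹ * ∑ i : Fin M, ENNReal.ofReal (w t (ζ t i))

/-- `ψ̄ = ψ.withDensity (Ĉ/C)`. -/
def smcBar (lam μ : Measure Z) (M : ℕ) {n : ℕ} (f : Z → Z → ℝ)
    (w : Fin (n + 1) → Z → ℝ) (C : ℝ≥0∞) : Measure (Fin (n + 1) → Fin M → Z) :=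
  (smcLaw lam μ M f w).withDensity (fun ζ => Chat M w ζ / C)

/-- Base measure of the conditional SMC particles given reference path `z` and slots `k`:
particle `(t, k_t)` is frozen at `z_t`, the others carry `μ` (at `t = 0`) or `λ`. -/
def condBase (lam μ : Measure Z) {n M : ℕ} (z : Fin (n + 1) → Z)
    (k : Fin (n + 1) → Fin M) : Measure (Fin (n + 1) → Fin M → Z) :=
  Measure.pi (fun t => Measure.pi (fun i =>
    if i = k t then Measure.dirac (z t) else if t = 0 then μ else lam))

/-- Density of the conditional SMC transitions (free particles only). -/
def condDens {n M : ℕ} (f : Z → Z → ℝ) (w : Fin (n + 1) → Z → ℝ)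
    (k : Fin (n + 1) → Fin M) (ζ : Fin (n + 1) → Fin M → Z) : ℝ≥0∞ :=
  ∏ s : Fin n, ∏ i : Fin M,
    if i = k s.succ then 1 else
      (∑ j : Fin M, ENNReal.ofReal (w s.castSucc (ζ s.castSucc j))
          * ENNReal.ofReal (f (ζ s.castSucc j) (ζ s.succ i)))
        / ∑ j : Fin M, ENNReal.ofReal (w s.castSucc (ζ s.castSucc j))

/-- The (extended) conditional SMC law `Φ(z, d(k, ζ))`. -/
def csmcLaw (lam μ : Measure Z) (M : ℕ) {n : ℕ} (f : Z → Z → ℝ)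
    (w : Fin (n + 1) → Z → ℝ) (z : Fin (n + 1) → Z) :
    Measure ((Fin (n + 1) → Fin M) × (Fin (n + 1) → Fin M → Z)) :=
  ∑ k : Fin (n + 1) → Fin M, (((M : ℝ≥0∞) ^ (n + 1))⁻¹) •
    (((condBase lam μ z k).withDensity (condDens f w k)).map (fun ζ => (k, ζ)))

/-- The backward-sampling probability `φ(k ∣ ζ)`. -/
def bsProb {n M : ℕ} (f : Z → Z → ℝ) (w : Fin (n + 1) → Z → ℝ)
    (k : Fin (n + 1) → Fin M) (ζ : Fin (n + 1) → Fin M → Z) : ℝ≥0∞ :=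
  (ENNReal.ofReal (w (Fin.last n) (ζ (Fin.last n) (k (Fin.last n))))
      / ∑ i : Fin M, ENNReal.ofReal (w (Fin.last n) (ζ (Fin.last n) i)))
    * ∏ s : Fin n,
      (ENNReal.ofReal (w s.castSucc (ζ s.castSucc (k s.castSucc)))
          * ENNReal.ofReal (f (ζ s.castSucc (k s.castSucc)) (ζ s.succ (k s.succ))))
        / ∑ i : Fin M, ENNReal.ofReal (w s.castSucc (ζ s.castSucc i))
            * ENNReal.ofReal (f (ζ s.castSucc i) (ζ s.succ (k s.succ)))

/-- The backward-sampling law `Φ̌(ζ, d(k, z))`. -/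
def bsLaw {M : ℕ} {n : ℕ} (f : Z → Z → ℝ) (w : Fin (n + 1) → Z → ℝ)
    (ζ : Fin (n + 1) → Fin M → Z) :
    Measure ((Fin (n + 1) → Fin M) × (Fin (n + 1) → Z)) :=
  ∑ k : Fin (n + 1) → Fin M,
    bsProb f w k ζ • Measure.dirac (k, fun t => ζ t (k t))

instance sigmaFinite_ite {α : Type*} [MeasurableSpace α] (p : Prop) [Decidable p]
    (μ ν : Measure α) [SigmaFinite μ] [SigmaFinite ν] : SigmaFinite (if p then μ else ν) := by
  split_ifs <;> infer_instance

section Update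

variable {ι α : Type*} [Fintype ι] [DecidableEq ι] [MeasurableSpace α]

/-- Overwriting a coordinate carrying a probability measure by a constant turns that
factor of the product measure into a Dirac mass. -/
theorem measurePreserving_update_const (ν : ι → Measure α) [∀ i, SigmaFinite (ν i)]
    (ρ : Measure α) [IsProbabilityMeasure ρ] (k : ι) (x : α) :
    MeasurePreserving (fun y : ι → α => Function.update y k x)
      (Measure.pi fun i => if i = k then ρ else ν i)
      (Measure.pi fun i => if i = k then Measure.dirac x else ν i) := by
  have h := measurePreserving_pi (fun i => if i = k then ρ else ν i)
    (fun i => if i = k then Measure.dirac x else ν i)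
    (f := fun i y => if i = k then x else y) (fun i => by
      by_cases hi : i = k
      · simp only [hi, if_true]
        exact ⟨measurable_const, by simp [Measure.map_const]⟩
      · simp only [hi, if_false]
        exact MeasurePreserving.id _)
  convert h using 1
  funext y i
  simp [Function.update_apply]

/-- Overwriting a coordinate carrying a probability measure by an independent sample from `ν k`
turns that factor of the product measure into `ν k`. -/
theorem measurePreserving_update_prod (ν : ι → Measure α) [∀ i, SigmaFinite (ν i)]
    (ρ : Measure α) [IsProbabilityMeasure ρ] (k : ι) :
    MeasurePreserving (fun p : α × (ι → α) => Function.update p.2 k p.1)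
      ((ν k).prod (Measure.pi fun i => if i = k then ρ else ν i)) (Measure.pi ν) := by
  have hm : Measurable (fun p : α × (ι → α) => Function.update p.2 k p.1) := by
    refine measurable_pi_lambda _ fun i => ?_
    by_cases hi : i = k
    · subst hi
      simpa using measurable_fst
    · simp only [Function.update_of_ne hi]
      fun_prop
  refine ⟨hm, (Measure.pi_eq fun s hs => ?_).symm⟩
  have hpre : (fun p : α × (ι → α) => Function.update p.2 k p.1) ⁻¹' Set.univ.pi s
      = s k ×ˢ Set.univ.pi (Function.update s k Set.univ) := by
    ext p
    simp only [Set.mem_preimage, Set.mem_univ_pi, Set.mem_prod]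
    constructor
    · refine fun h => ⟨by simpa using h k, fun i => ?_⟩
      by_cases hi : i = k
      · subst hi; simp
      · simpa [hi] using h i
    · rintro ⟨h1, h2⟩ i
      by_cases hi : i = k
      · subst hi; simpa using h1
      · simpa [hi] using h2 i
  rw [Measure.map_apply hm (MeasurableSet.univ_pi hs), hpre, Measure.prod_prod, Measure.pi_pi,
    ← Finset.mul_prod_erase Finset.univ (fun i => ν i (s i)) (Finset.mem_univ k),
    ← Finset.mul_prod_erase Finset.univ _ (Finset.mem_univ k)]
  simp only [Function.update_self, if_true, measure_univ, one_mul]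
  congr 1
  refine Finset.prod_congr rfl fun i hi => ?_
  have hi := Finset.ne_of_mem_erase hi
  simp [hi]

end Update

/-- Place the path `z` in the slots `k` of the particle system `ζ`. -/
def insertPath {n M : ℕ} (k : Fin (n + 1) → Fin M) (z : Fin (n + 1) → Z)
    (ζ : Fin (n + 1) → Fin M → Z) : Fin (n + 1) → Fin M → Z :=
  fun t => Function.update (ζ t) (k t) (z t)

/-- Product measure on particle space whose factors in the slots `k` are the probability
measure `μ`. -/
def freeBase (lam μ : Measure Z) {n M : ℕ} (k : Fin (n + 1) → Fin M) :
    Measure (Fin (n + 1) → Fin M → Z) :=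
  Measure.pi (fun t => Measure.pi (fun i =>
    if i = k t then μ else if t = 0 then μ else lam))

instance (lam μ : Measure Z) [SigmaFinite lam] [IsProbabilityMeasure μ] {n M : ℕ}
    (k : Fin (n + 1) → Fin M) : SigmaFinite (freeBase lam μ k) := by
  unfold freeBase; infer_instance

instance (lam μ : Measure Z) [SigmaFinite lam] [IsProbabilityMeasure μ] (n : ℕ) :
    SigmaFinite (pathBase lam μ n) := by
  unfold pathBase; infer_instance

theorem insertPath_apply_self {Z : Type*} {n M : ℕ} (k : Fin (n + 1) → Fin M) (z : Fin (n + 1) → Z)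
    (ζ : Fin (n + 1) → Fin M → Z) : (fun t => insertPath k z ζ t (k t)) = z := by
  funext t
  simp [insertPath]

theorem measurePreserving_insertPath_condBase (lam μ : Measure Z) [SigmaFinite lam]
    [IsProbabilityMeasure μ] {n M : ℕ} (k : Fin (n + 1) → Fin M) (z : Fin (n + 1) → Z) :
    MeasurePreserving (insertPath k z) (freeBase lam μ k) (condBase lam μ z k) :=
  measurePreserving_pi _ _ fun t =>
    measurePreserving_update_const (fun _ => if t = 0 then μ else lam) μ (k t) (z t)

theorem measurePreserving_insertPath_prod (lam μ : Measure Z) [SigmaFinite lam]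
    [IsProbabilityMeasure μ] {n M : ℕ} (k : Fin (n + 1) → Fin M) :
    MeasurePreserving (fun p : (Fin (n + 1) → Z) × (Fin (n + 1) → Fin M → Z) =>
        insertPath k p.1 p.2)
      ((pathBase lam μ n).prod (freeBase lam μ k)) (particleBase lam μ n M) := by
  have h1 := (measurePreserving_arrowProdEquivProdArrow Z (Fin M → Z) (Fin (n + 1))
    (fun t => if t = 0 then μ else lam)
    (fun t => Measure.pi (fun i => if i = k t then μ else if t = 0 then μ else lam))).symm
  have h2 := measurePreserving_pi
    (fun t : Fin (n + 1) => (if t = 0 then μ else lam).prod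
      (Measure.pi (fun i => if i = k t then μ else if t = 0 then μ else lam)))
    (fun t => Measure.pi (fun _ : Fin M => if t = 0 then μ else lam)) fun t =>
      measurePreserving_update_prod (fun _ => if t = 0 then μ else lam) μ (k t)
  exact h2.comp h1

/-- The pointwise identity between the densities of the two sides of the exchange identity. -/
theorem density_exchange {Z : Type*} {n M : ℕ} (hM : 1 ≤ M) {f : Z → Z → ℝ} (hfpos : ∀ z z', 0 < f z z')
    {w : Fin (n + 1) → Z → ℝ} (hwpos : ∀ t z, 0 < w t z)
    (k : Fin (n + 1) → Fin M) (ζ : Fin (n + 1) → Fin M → Z) :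
    pathDens f w (fun t => ζ t (k t)) * (((M : ℝ≥0∞) ^ (n + 1))⁻¹ * condDens f w k ζ)
      = resampleDens f w ζ * (Chat M w ζ * bsProb f w k ζ) := by
  have : NeZero M := ⟨by omega⟩
  have sum_ne : ∀ g : Fin M → ℝ≥0∞, (∀ j, g j ≠ 0) → ∑ j, g j ≠ 0 := fun g hg h =>
    hg 0 (Finset.sum_eq_zero_iff.1 h 0 (Finset.mem_univ _))
  set W : Fin (n + 1) → ℝ≥0∞ := fun t => ∑ j : Fin M, ENNReal.ofReal (w t (ζ t j)) with hW
  set N : Fin n → Fin M → ℝ≥0∞ := fun s i =>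
    ∑ j : Fin M, ENNReal.ofReal (w s.castSucc (ζ s.castSucc j))
        * ENNReal.ofReal (f (ζ s.castSucc j) (ζ s.succ i)) with hN
  have hW0 : ∀ t, W t ≠ 0 := fun t => sum_ne _ fun j => by simp [hwpos]
  have hWt : ∀ t, W t ≠ ⊤ := fun t => by simp [hW]
  have hN0 : ∀ s i, N s i ≠ 0 := fun s i => sum_ne _ fun j => by simp [hwpos, hfpos]
  have hNt : ∀ s i, N s i ≠ ⊤ := fun s i => by simp [hN, ENNReal.mul_eq_top]
  have hres : resampleDens f w ζ
      = (∏ s : Fin n, N s (k s.succ) / W s.castSucc) * condDens f w k ζ := by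
    unfold resampleDens condDens
    rw [← Finset.prod_mul_distrib]
    refine Finset.prod_congr rfl fun s _ => ?_
    rw [← Finset.mul_prod_erase Finset.univ _ (Finset.mem_univ (k s.succ)),
      ← Finset.mul_prod_erase Finset.univ _ (Finset.mem_univ (k s.succ)), if_pos rfl, one_mul]
    congr 1
    exact Finset.prod_congr rfl fun i hi => (if_neg (Finset.ne_of_mem_erase hi)).symm
  have hChat : Chat M w ζ = ((M : ℝ≥0∞) ^ (n + 1))⁻¹
      * ((∏ s : Fin n, W s.castSucc) * W (Fin.last n)) := by
    unfold Chat
    rw [Finset.prod_mul_distrib, ← Fin.prod_univ_castSucc]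
    simp [hW, ENNReal.inv_pow]
  set a : Fin (n + 1) → ℝ≥0∞ := fun t => ENNReal.ofReal (w t (ζ t (k t)))
  set b : Fin n → ℝ≥0∞ := fun s =>
    ENNReal.ofReal (f (ζ s.castSucc (k s.castSucc)) (ζ s.succ (k s.succ)))
  have hpath : pathDens f w (fun t => ζ t (k t))
      = a (Fin.last n) * ∏ s : Fin n, a s.castSucc * b s := by
    unfold pathDens
    rw [Fin.prod_univ_castSucc, Finset.prod_mul_distrib]
    ring
  have hbs : bsProb f w k ζ = a (Fin.last n) / W (Fin.last n)
      * ∏ s : Fin n, a s.castSucc * b s / N s (k s.succ) := rfl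
  have hlast : a (Fin.last n) = W (Fin.last n) * (a (Fin.last n) / W (Fin.last n)) :=
    (ENNReal.mul_div_cancel (hW0 _) (hWt _)).symm
  have hprod : ∏ s : Fin n, a s.castSucc * b s
      = (∏ s : Fin n, N s (k s.succ) / W s.castSucc) * (∏ s : Fin n, W s.castSucc)
        * ∏ s : Fin n, a s.castSucc * b s / N s (k s.succ) := by
    rw [← Finset.prod_mul_distrib, ← Finset.prod_mul_distrib]
    refine Finset.prod_congr rfl fun s _ => ?_
    rw [ENNReal.div_mul_cancel (hW0 _) (hWt _), ENNReal.mul_div_cancel (hN0 _ _) (hNt _ _)]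
  rw [hpath, hres, hChat, hbs, hprod]
  nth_rw 1 [hlast]
  ring

section Measurability

variable {n M : ℕ} {f : Z → Z → ℝ} {w : Fin (n + 1) → Z → ℝ}

theorem measurable_pathDens (hfm : Measurable (Function.uncurry f))
    (hwm : ∀ t, Measurable (w t)) : Measurable (pathDens f w) := by
  have hf : ∀ s : Fin n, Measurable fun z : Fin (n + 1) → Z => f (z s.castSucc) (z s.succ) :=
    fun s => hfm.comp (by fun_prop : Measurable fun z : Fin (n + 1) → Z =>
      (z s.castSucc, z s.succ))
  unfold pathDens
  fun_prop

theorem measurable_trans (hfm : Measurable (Function.uncurry f)) (s : Fin n) (i j : Fin M) :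
    Measurable fun ζ : Fin (n + 1) → Fin M → Z => f (ζ s.castSucc j) (ζ s.succ i) :=
  hfm.comp (by fun_prop : Measurable fun ζ : Fin (n + 1) → Fin M → Z =>
    (ζ s.castSucc j, ζ s.succ i))

theorem measurable_resampleDens (hfm : Measurable (Function.uncurry f))
    (hwm : ∀ t, Measurable (w t)) : Measurable (resampleDens (M := M) f w) := by
  have hf := measurable_trans (n := n) (M := M) hfm
  unfold resampleDens
  fun_prop

theorem measurable_Chat (hwm : ∀ t, Measurable (w t)) : Measurable (Chat M w) := by
  unfold Chat
  fun_prop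

theorem measurable_condDens (hfm : Measurable (Function.uncurry f))
    (hwm : ∀ t, Measurable (w t)) (k : Fin (n + 1) → Fin M) : Measurable (condDens f w k) := by
  have hf := measurable_trans (n := n) (M := M) hfm
  unfold condDens
  refine Finset.measurable_prod _ fun s _ => Finset.measurable_prod _ fun i _ => ?_
  split_ifs <;> fun_prop

theorem measurable_bsProb (hfm : Measurable (Function.uncurry f))
    (hwm : ∀ t, Measurable (w t)) (k : Fin (n + 1) → Fin M) : Measurable (bsProb f w k) := by
  have hf := measurable_trans (n := n) (M := M) hfm
  unfold bsProb
  fun_prop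

end Measurability

/-- The extended conditional SMC law, evaluated on a set, as an integral against `freeBase`. -/
theorem csmcLaw_map_apply (lam μ : Measure Z) [SigmaFinite lam] [IsProbabilityMeasure μ]
    {n M : ℕ} {f : Z → Z → ℝ} (hfm : Measurable (Function.uncurry f))
    {w : Fin (n + 1) → Z → ℝ} (hwm : ∀ t, Measurable (w t)) (z : Fin (n + 1) → Z)
    {S : Set ((Fin (n + 1) → Z) × (Fin (n + 1) → Fin M) × (Fin (n + 1) → Fin M → Z))}
    (hS : MeasurableSet S) :
    (csmcLaw lam μ M f w z).map (fun p => (z, p.1, p.2)) S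
      = ∑ k : Fin (n + 1) → Fin M, ∫⁻ ζ, ((M : ℝ≥0∞) ^ (n + 1))⁻¹
          * condDens f w k (insertPath k z ζ) * S.indicator 1 (z, k, insertPath k z ζ)
          ∂(freeBase lam μ k) := by
  rw [Measure.map_apply (by fun_prop) hS]
  unfold csmcLaw
  rw [Measure.finsetSum_apply]
  refine Finset.sum_congr rfl fun k _ => ?_
  have hm : Measurable fun ζ : Fin (n + 1) → Fin M → Z => (z, k, ζ) := by fun_prop
  have hk := measurable_condDens hfm hwm k
  have hI : Measurable fun ζ : Fin (n + 1) → Fin M → Z =>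
      condDens f w k ζ * S.indicator 1 (z, k, ζ) :=
    hk.mul ((measurable_one.indicator hS).comp hm)
  rw [Measure.smul_apply, Measure.map_apply (by fun_prop) (hS.preimage (by fun_prop)),
    smul_eq_mul]
  change _ * (condBase lam μ z k).withDensity _ ((fun ζ => (z, k, ζ)) ⁻¹' S) = _
  rw [withDensity_apply _ (hS.preimage hm), ← lintegral_indicator (hS.preimage hm)]
  simp only [mul_assoc]
  have hp := measurePreserving_insertPath_condBase lam μ k z
  refine Eq.trans ?_ (lintegral_const_mul _ (hI.comp hp.measurable)).symm
  refine congrArg _ (Eq.trans ?_ (hp.lintegral_comp hI).symm)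
  refine lintegral_congr fun ζ => ?_
  by_cases h : (z, k, ζ) ∈ S <;> simp [Set.indicator, h]

theorem bsLaw_map_apply {n M : ℕ} (f : Z → Z → ℝ) (w : Fin (n + 1) → Z → ℝ)
    (ζ : Fin (n + 1) → Fin M → Z)
    {S : Set ((Fin (n + 1) → Z) × (Fin (n + 1) → Fin M) × (Fin (n + 1) → Fin M → Z))}
    (hS : MeasurableSet S) :
    (bsLaw f w ζ).map (fun p => (p.2, p.1, ζ)) S
      = ∑ k : Fin (n + 1) → Fin M,
          bsProb f w k ζ * S.indicator 1 ((fun t => ζ t (k t)), k, ζ) := by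
  have hm : Measurable fun p : (Fin (n + 1) → Fin M) × (Fin (n + 1) → Z) => (p.2, p.1, ζ) := by
    fun_prop
  rw [Measure.map_apply hm hS]
  unfold bsLaw
  rw [Measure.finsetSum_apply]
  refine Finset.sum_congr rfl fun k _ => ?_
  rw [Measure.smul_apply, Measure.dirac_apply' _ (hS.preimage hm), smul_eq_mul]
  rfl

/-- **Exchange identity between conditional SMC and backward sampling (Lemma
`lem: cSMC semi-reversibility` of Andrieu, Doucet, Yıldırım & Chopin):**
`π(dz) Φ(z, d(k, ζ)) = ψ̄(dζ) Φ̌(ζ, d(k, z))` as measures on `Z^T × [M]^T × Z^{MT}`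
(here `T = n + 1 ≥ 1`). -/
theorem csmc_exchange_identity
    (lam : Measure Z) [SigmaFinite lam] (μ : Measure Z) [IsProbabilityMeasure μ]
    (n M : ℕ) (hM : 1 ≤ M)
    (f : Z → Z → ℝ) (hfm : Measurable (Function.uncurry f))
    (hfpos : ∀ z z', 0 < f z z')
    (hfMarkov : ∀ z, ∫⁻ z', ENNReal.ofReal (f z z') ∂lam = 1)
    (w : Fin (n + 1) → Z → ℝ) (hwm : ∀ t, Measurable (w t))
    (hwpos : ∀ t z, 0 < w t z)
    (C : ℝ≥0∞) (hC : C = ∫⁻ z, pathDens f w z ∂(pathBase lam μ n))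
    (hCpos : 0 < C) (hCfin : C ≠ ⊤) :
    (targetLaw lam μ f w C).bind (fun z =>
        (csmcLaw lam μ M f w z).map (fun p => (z, p.1, p.2)))
      = (smcBar lam μ M f w C).bind (fun ζ =>
          (bsLaw f w ζ).map (fun p => (p.2, p.1, ζ))) := by
  have hpd := measurable_pathDens hfm hwm
  have hins : ∀ k : Fin (n + 1) → Fin M,
      Measurable fun p : (Fin (n + 1) → Z) × (Fin (n + 1) → Fin M → Z) =>
        insertPath k p.1 p.2 := fun k => (measurePreserving_insertPath_prod lam μ k).measurable
  have hL : ∀ (S : Set ((Fin (n + 1) → Z) × (Fin (n + 1) → Fin M) ×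
      (Fin (n + 1) → Fin M → Z))), MeasurableSet S → ∀ k : Fin (n + 1) → Fin M,
      Measurable fun p : (Fin (n + 1) → Z) × (Fin (n + 1) → Fin M → Z) =>
        ((M : ℝ≥0∞) ^ (n + 1))⁻¹ * condDens f w k (insertPath k p.1 p.2)
          * S.indicator 1 (p.1, k, insertPath k p.1 p.2) := fun S hS k =>
    (((measurable_condDens hfm hwm k).comp (hins k)).const_mul _).mul
      ((measurable_one.indicator hS).comp
        (measurable_fst.prodMk (measurable_const.prodMk (hins k))))
  have hR : ∀ (S : Set ((Fin (n + 1) → Z) × (Fin (n + 1) → Fin M) ×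
      (Fin (n + 1) → Fin M → Z))), MeasurableSet S → ∀ k : Fin (n + 1) → Fin M,
      Measurable fun ζ : Fin (n + 1) → Fin M → Z =>
        bsProb f w k ζ * S.indicator 1 ((fun t => ζ t (k t)), k, ζ) := fun S hS k =>
    (measurable_bsProb hfm hwm k).mul ((measurable_one.indicator hS).comp (by fun_prop))
  have hcs : Measurable fun z => (csmcLaw lam μ M f w z).map (fun p => (z, p.1, p.2)) := by
    refine Measure.measurable_of_measurable_coe _ fun S hS => ?_
    simp only [csmcLaw_map_apply lam μ hfm hwm _ hS]
    exact Finset.measurable_sum _ fun k _ => (hL S hS k).lintegral_prod_right'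
  have hbs : Measurable fun ζ : Fin (n + 1) → Fin M → Z =>
      (bsLaw f w ζ).map (fun p => (p.2, p.1, ζ)) := by
    refine Measure.measurable_of_measurable_coe _ fun S hS => ?_
    simp only [bsLaw_map_apply f w _ hS]
    exact Finset.measurable_sum _ fun k _ => hR S hS k
  ext S hS
  rw [Measure.bind_apply hS hcs.aemeasurable, Measure.bind_apply hS hbs.aemeasurable]
  simp only [csmcLaw_map_apply lam μ hfm hwm _ hS, bsLaw_map_apply f w _ hS]
  rw [lintegral_finsetSum _ fun k _ => (hL S hS k).lintegral_prod_right',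
    lintegral_finsetSum _ fun k _ => hR S hS k]
  refine Finset.sum_congr rfl fun k _ => ?_
  have hchat : Measurable fun ζ : Fin (n + 1) → Fin M → Z => Chat M w ζ / C :=
    (measurable_Chat hwm).div_const C
  have hG : Measurable fun ζ : Fin (n + 1) → Fin M → Z =>
      resampleDens f w ζ * (Chat M w ζ / C *
        (bsProb f w k ζ * S.indicator 1 ((fun t => ζ t (k t)), k, ζ))) :=
    (measurable_resampleDens hfm hwm).mul (hchat.mul (hR S hS k))
  unfold targetLaw smcBar smcLaw
  rw [lintegral_withDensity_eq_lintegral_mul _ (hpd.const_mul _) (hL S hS k).lintegral_prod_right',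
    lintegral_withDensity_eq_lintegral_mul _ hchat (hR S hS k),
    lintegral_withDensity_eq_lintegral_mul _ (measurable_resampleDens hfm hwm)
      (hchat.mul (hR S hS k))]
  simp only [Pi.mul_apply]
  rw [← (measurePreserving_insertPath_prod lam μ k).lintegral_comp hG]
  refine Eq.trans ?_ (lintegral_prod _ (hG.comp (hins k)).aemeasurable).symm
  refine lintegral_congr fun z => ?_
  refine (lintegral_const_mul _ ((hL S hS k).comp measurable_prodMk_left)).symm.trans ?_
  refine lintegral_congr fun ζ => ?_
  have hd := density_exchange hM hfpos hwpos k (insertPath k z ζ)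
  simp only [Function.comp_apply, insertPath_apply_self] at hd ⊢
  calc _ = C⁻¹ * S.indicator 1 (z, k, insertPath k z ζ) * (pathDens f w z *
          (((M : ℝ≥0∞) ^ (n + 1))⁻¹ * condDens f w k (insertPath k z ζ))) := by ring
    _ = _ := by rw [hd, div_eq_mul_inv]; ring

end CSMC
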